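/- Assume 𝕎 has a finite positive limit L = lim_{c→∞} 𝕎(c). Then lim_{c→∞} [ z^{(q)}(c;0) − q∫_b^c 𝕎(c−y) z^{(q)}(y;0) dy ] / 𝕎(c) = 1/L + q∫₀^b ( ℤ^{(q)}(y) − α W^{(q)}(y) ℤ^{(q)}(b−y) ) dy. -/

import Mathlib

open MeasureTheory Set Filter Topology

/-- The Laplace exponent of a spectrally negative Lévy process with triplet `(γ, σ, ν)`. -/
noncomputable def levyPsi (γ σ : ℝ) (ν : Measure ℝ) (l : ℝ) : ℝ :=
  γ * l + σ ^ 2 / 2 * l ^ 2 +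
    ∫ z in Set.Ioi (0 : ℝ),
      (Real.exp (-l * z) - 1 +
        l * z * Set.indicator (Set.Ioc (0 : ℝ) 1) (fun _ => (1 : ℝ)) z) ∂ν

/-- The right-inverse `Φ(q) = sup {λ ≥ 0 : f(λ) = q}` of a Laplace exponent `f`. -/
noncomputable def levyPhi (f : ℝ → ℝ) (q : ℝ) : ℝ :=
  sSup {l : ℝ | 0 ≤ l ∧ f l = q}

/-- `∫₀¹ z ν(dz)`, as an extended nonnegative real. -/
noncomputable def smallJumpMass (ν : Measure ℝ) : ENNReal :=
  ∫⁻ z in Set.Ioc (0 : ℝ) 1, ENNReal.ofReal z ∂ν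

/-- `ν` is a Lévy measure on `(0,∞)`: it charges only `(0,∞)` and
integrates `min(1, z²)`. -/
def IsLevyMeasure (ν : Measure ℝ) : Prop :=
  ν (Set.Iic 0) = 0 ∧ (∫⁻ z in Set.Ioi (0 : ℝ), ENNReal.ofReal (min 1 (z ^ 2)) ∂ν) ≠ ⊤

/-- The process is not the negative of a subordinator: `σ > 0`, or
`∫₀¹ z ν(dz) = ∞`, or `γ + ∫₀¹ z ν(dz) > 0`. -/
def NonDegenerate (γ σ : ℝ) (ν : Measure ℝ) : Prop :=
  0 < σ ∨ smallJumpMass ν = ⊤ ∨ 0 < γ + (smallJumpMass ν).toReal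

/-- `W` is the `q`-scale function associated with the Laplace exponent `f`,
where `Φq` is the value of the right-inverse of `f` at `q`. -/
def IsScaleFunction (f : ℝ → ℝ) (Φq q : ℝ) (W : ℝ → ℝ) : Prop :=
  (∀ x < 0, W x = 0) ∧ ContinuousOn W (Set.Ici 0) ∧ MonotoneOn W (Set.Ici 0) ∧
    ∀ l, Φq < l → (∫ y in Set.Ioi (0 : ℝ), Real.exp (-l * y) * W y) = 1 / (f l - q)

/-- Admissibility of the refraction parameter `α`: `α > 0`, and when the paths
have bounded variation (`σ = 0` and `∫₀¹ z ν(dz) < ∞`), `α` is smaller than the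
drift `c = γ + ∫₀¹ z ν(dz)`. -/
def AlphaAdmissible (γ σ α : ℝ) (ν : Measure ℝ) : Prop :=
  0 < α ∧ ((σ = 0 ∧ smallJumpMass ν ≠ ⊤) → α < γ + (smallJumpMass ν).toReal)

/-- The function `w^{(q)}(·;0)` associated with the refracted process:
`w^{(q)}(x;0) = W^{(q)}(x) + α·1_{{x ≥ b}}∫_b^x 𝕎^{(q)}(x-y) W^{(q)′}(y) dy`. -/
noncomputable def refractedW (α b : ℝ) (W W' Wαq : ℝ → ℝ) (x : ℝ) : ℝ :=
  W x + α * (if b ≤ x then ∫ y in b..x, Wαq (x - y) * W' y else 0)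

/-- The function `z^{(q)}(·;0)` associated with the refracted process:
`z^{(q)}(x;0) = Z^{(q)}(x) + αq·1_{{x ≥ b}}∫_b^x 𝕎^{(q)}(x-y) W^{(q)}(y) dy`,
where `Z^{(q)}(x) = 1 + q∫₀ˣ W^{(q)}(y) dy`. -/
noncomputable def refractedZ (α b q : ℝ) (W Wαq : ℝ → ℝ) (x : ℝ) : ℝ :=
  (1 + q * ∫ y in (0:ℝ)..x, W y) +
    α * q * (if b ≤ x then ∫ y in b..x, Wαq (x - y) * W y else 0)

/-- Uniqueness of the Laplace transform from its values at the natural numbers. -/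
theorem ae_eq_zero_of_forall_nat_laplace_eq_zero {G : ℝ → ℝ} (hG : IntegrableOn G (Ioi 0))
    (h : ∀ n : ℕ, ∫ y in Ioi (0 : ℝ), Real.exp (-(n * y)) * G y = 0) :
    ∀ᵐ y : ℝ, y ∈ Ioi (0 : ℝ) → G y = 0 := by
  have hbdd : ∀ φ : ℝ → ℝ, Continuous φ →
      IntegrableOn (fun y => φ (Real.exp (-y)) * G y) (Ioi 0) := by
    intro φ hφ
    obtain ⟨C, hC⟩ := isCompact_Icc.exists_bound_of_continuousOn
      (hφ.continuousOn (s := Icc (0 : ℝ) 1))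
    refine Integrable.bdd_mul (c := C) hG (by fun_prop) ?_
    refine (ae_restrict_iff' measurableSet_Ioi).2 (ae_of_all _ fun y hy => hC _ ?_)
    exact ⟨(Real.exp_pos _).le, Real.exp_le_one_iff.2 (neg_nonpos.2 (le_of_lt hy))⟩
  have hpoly : ∀ p : Polynomial ℝ,
      ∫ y in Ioi (0 : ℝ), p.eval (Real.exp (-y)) * G y = 0 := by
    intro p
    simp_rw [Polynomial.eval_eq_sum_range, Finset.sum_mul]
    rw [integral_finsetSum]
    · refine Finset.sum_eq_zero fun i _ => ?_
      simp_rw [mul_assoc, integral_const_mul, ← Real.exp_nat_mul]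
      simp_rw [mul_neg, h i, mul_zero]
    · intro i _
      exact hbdd (fun t => p.coeff i * t ^ i) (by fun_prop)
  refine isOpen_Ioi.ae_eq_zero_of_integral_contDiff_smul_eq_zero hG.locallyIntegrableOn
    fun g hg hgc hgs => ?_
  rw [← setIntegral_eq_integral_of_forall_compl_eq_zero (s := Ioi (0 : ℝ))]
  swap
  · intro y hy
    rw [image_eq_zero_of_notMem_tsupport fun hy' => hy (hgs hy'), zero_smul]
  simp_rw [smul_eq_mul]
  have hg0 : g 0 = 0 := image_eq_zero_of_notMem_tsupport fun h' => lt_irrefl (0 : ℝ) (hgs h')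
  have hφ : Continuous fun t => g (-Real.log t) := by
    refine continuous_iff_continuousAt.2 fun t => ?_
    rcases eq_or_ne t 0 with rfl | ht
    · rw [continuousAt_iff_punctured_nhds]
      simp only [Real.log_zero, neg_zero, hg0]
      exact (hgc.is_zero_at_infty.mono_left atTop_le_cocompact).comp
        (tendsto_neg_atBot_atTop.comp Real.tendsto_log_nhdsNE_zero)
    · exact hg.continuous.continuousAt.comp (Real.continuousAt_log ht).neg
  have hbound : ∀ ε > 0, |∫ y in Ioi (0 : ℝ), g y * G y| ≤ ε * ∫ y in Ioi (0 : ℝ), |G y| := by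
    intro ε hε
    obtain ⟨p, hp⟩ := exists_polynomial_near_of_continuousOn 0 1 _ hφ.continuousOn ε hε
    have hgG : IntegrableOn (fun y => g y * G y) (Ioi 0) := by
      simpa using hbdd _ hφ
    have hsub : ∫ y in Ioi (0 : ℝ), g y * G y =
        ∫ y in Ioi (0 : ℝ), (g y * G y - p.eval (Real.exp (-y)) * G y) := by
      rw [integral_sub hgG (hbdd _ p.continuous), hpoly, sub_zero]
    rw [hsub, ← integral_const_mul, ← Real.norm_eq_abs]
    refine norm_integral_le_of_norm_le (hG.abs.const_mul ε) ?_
    refine (ae_restrict_iff' measurableSet_Ioi).2 (ae_of_all _ fun y hy => ?_)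
    have := hp (Real.exp (-y))
      ⟨(Real.exp_pos _).le, Real.exp_le_one_iff.2 (neg_nonpos.2 (le_of_lt hy))⟩
    rw [Real.log_exp, neg_neg, abs_sub_comm] at this
    rw [← sub_mul, Real.norm_eq_abs, abs_mul]
    gcongr
  have hnonneg : 0 ≤ ∫ y in Ioi (0 : ℝ), |G y| := integral_nonneg fun _ => abs_nonneg _
  refine abs_nonpos_iff.1 (le_of_forall_pos_le_add fun ε hε => ?_)
  refine (hbound (ε / ((∫ y in Ioi (0 : ℝ), |G y|) + 1)) (by positivity)).trans ?_
  rw [zero_add, div_mul_eq_mul_div, div_le_iff₀ (by positivity)]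
  nlinarith

/-- `f` has an absolutely convergent Laplace transform at `l`, with value `a`. -/
def HasLaplace (f : ℝ → ℝ) (l a : ℝ) : Prop :=
  IntegrableOn (fun y => Real.exp (-l * y) * f y) (Ioi 0) ∧
    ∫ y in Ioi (0 : ℝ), Real.exp (-l * y) * f y = a

namespace HasLaplace

variable {f g : ℝ → ℝ} {l a c : ℝ}

theorem congr (hf : HasLaplace f l a) (h : EqOn f g (Ioi 0)) : HasLaplace g l a := by
  have h' : EqOn (fun y => Real.exp (-l * y) * f y) (fun y => Real.exp (-l * y) * g y)
      (Ioi 0) := fun y hy => by simp only [h hy]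
  exact ⟨hf.1.congr_fun h' measurableSet_Ioi,
    (setIntegral_congr_fun measurableSet_Ioi h').symm.trans hf.2⟩

theorem add (hf : HasLaplace f l a) (hg : HasLaplace g l c) :
    HasLaplace (fun y => f y + g y) l (a + c) := by
  simp only [HasLaplace, mul_add]
  exact ⟨hf.1.add hg.1, by rw [integral_add hf.1 hg.1, hf.2, hg.2]⟩

theorem sub (hf : HasLaplace f l a) (hg : HasLaplace g l c) :
    HasLaplace (fun y => f y - g y) l (a - c) := by
  simp only [HasLaplace, mul_sub]
  exact ⟨hf.1.sub hg.1, by rw [integral_sub hf.1 hg.1, hf.2, hg.2]⟩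

theorem const_mul (r : ℝ) (hf : HasLaplace f l a) :
    HasLaplace (fun y => r * f y) l (r * a) := by
  simp only [HasLaplace, mul_left_comm _ r]
  exact ⟨hf.1.const_mul r, by rw [integral_const_mul, hf.2]⟩

theorem one (hl : 0 < l) : HasLaplace (fun _ => 1) l (1 / l) := by
  simp only [HasLaplace, mul_one]
  exact ⟨exp_neg_integrableOn_Ioi 0 hl, by
    simpa using integral_exp_mul_Ioi (neg_lt_zero.2 hl) 0⟩

theorem conv (hf : HasLaplace f l a) (hg : HasLaplace g l c) :
    HasLaplace (fun x => ∫ y in (0 : ℝ)..x, f (x - y) * g y) l (a * c) := by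
  have key : ∀ x, Real.exp (-l * x) * (∫ y in (0 : ℝ)..x, f (x - y) * g y) =
      ∫ y in (0 : ℝ)..x, ContinuousLinearMap.mul ℝ ℝ (Real.exp (-l * y) * g y)
        (Real.exp (-l * (x - y)) * f (x - y)) := by
    intro x
    rw [← intervalIntegral.integral_const_mul]
    congr 1 with y
    have : Real.exp (-l * x) = Real.exp (-l * y) * Real.exp (-l * (x - y)) := by
      rw [← Real.exp_add]; ring_nf
    rw [this, ContinuousLinearMap.mul_apply']
    ring
  simp only [HasLaplace, key]
  refine ⟨?_, ?_⟩
  · have := integrable_posConvolution hg.1 hf.1 (ContinuousLinearMap.mul ℝ ℝ)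
    rwa [posConvolution, integrable_indicator_iff measurableSet_Ioi] at this
  · rw [integral_posConvolution hg.1 hf.1, hf.2, hg.2, ContinuousLinearMap.mul_apply', mul_comm]

theorem primitive (hl : 0 < l) (hf : HasLaplace f l a) :
    HasLaplace (fun x => ∫ y in (0 : ℝ)..x, f y) l (a / l) := by
  have h := (one hl).conv hf
  simpa only [one_mul, one_div, div_eq_inv_mul, mul_one] using h

/-- Continuous functions with the same Laplace transform near infinity agree. -/
theorem eqOn (hf : Continuous f) (hg : Continuous g) {F : ℝ → ℝ} {l₀ : ℝ}
    (hfF : ∀ l > l₀, HasLaplace f l (F l)) (hgF : ∀ l > l₀, HasLaplace g l (F l)) :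
    EqOn f g (Ici 0) := by
  have hd : ∀ l > l₀, HasLaplace (fun y => f y - g y) l 0 := fun l hl => by
    simpa using (hfF l hl).sub (hgF l hl)
  have hae := ae_eq_zero_of_forall_nat_laplace_eq_zero (hd (l₀ + 1) (by linarith)).1 fun n => by
    refine Eq.trans (setIntegral_congr_fun measurableSet_Ioi fun y _ => ?_)
      (hd (l₀ + 1 + n) (by linarith [n.cast_nonneg (α := ℝ)])).2
    simp only [← mul_assoc, ← Real.exp_add]
    ring_nf
  have hae' : f =ᵐ[volume.restrict (Ioi 0)] g :=
    (ae_restrict_iff' measurableSet_Ioi).2 (hae.mono fun y hy hy0 => by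
      simpa [Real.exp_ne_zero, sub_eq_zero] using hy hy0)
  have h := Measure.eqOn_open_of_ae_eq hae' isOpen_Ioi hf.continuousOn hg.continuousOn
  simpa [closure_Ioi] using h.closure hf hg

end HasLaplace

section Refraction

variable {A B V : ℝ → ℝ} {α q b : ℝ}

theorem refractedZ_eq_of_convolution (hA : Continuous A) (hV : Continuous V) (hb : 0 ≤ b)
    (h : ∀ x ≥ 0, (∫ y in (0 : ℝ)..x, A y) - ∫ y in (0 : ℝ)..x, V y =
      α * ∫ y in (0 : ℝ)..x, A (x - y) * V y) {x : ℝ} (hx : b ≤ x) :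
    refractedZ α b q V A x = (1 + q * ∫ y in (0 : ℝ)..x, A y) -
      α * q * ∫ u in (0 : ℝ)..b, A (x - u) * V u := by
  have hi : ∀ s t, IntervalIntegrable (fun y => A (x - y) * V y) volume s t := fun s t =>
    Continuous.intervalIntegrable (by fun_prop) s t
  have hsplit := intervalIntegral.integral_add_adjacent_intervals (hi 0 b) (hi b x)
  rw [refractedZ, if_pos hx]
  linear_combination (α * q) * hsplit - q * h x (hb.trans hx)

theorem refractedZ_sub_convolution_eq (hA : Continuous A) (hB : Continuous B)
    (hV : Continuous V) (hb : 0 ≤ b)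
    (hAB : ∀ x ≥ 0, A x - B x = q * ∫ y in (0 : ℝ)..x, B (x - y) * A y)
    (hAV : ∀ x ≥ 0, (∫ y in (0 : ℝ)..x, A y) - ∫ y in (0 : ℝ)..x, V y =
      α * ∫ y in (0 : ℝ)..x, A (x - y) * V y)
    (hBZ : ∀ x ≥ 0, ∫ y in (0 : ℝ)..x, B (x - y) * (1 + q * ∫ z in (0 : ℝ)..y, A z) =
      ∫ y in (0 : ℝ)..x, A y) {c : ℝ} (hc : b ≤ c) :
    refractedZ α b q V A c - q * ∫ y in b..c, B (c - y) * refractedZ α b q V A y =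
      1 + q * (∫ y in (0 : ℝ)..b, B (c - y) * (1 + q * ∫ z in (0 : ℝ)..y, A z)) -
        α * q * ∫ u in (0 : ℝ)..b,
          V u * (B (c - u) + q * ∫ v in (0 : ℝ)..(b - u), B (c - u - v) * A v) := by
  have hZ : Continuous fun y => 1 + q * ∫ z in (0 : ℝ)..y, A z := by fun_prop
  have hinner : ∀ u ∈ uIcc 0 b, q * ∫ y in b..c, B (c - y) * A (y - u) =
      A (c - u) - B (c - u) - q * ∫ v in (0 : ℝ)..(b - u), B (c - u - v) * A v := by
    intro u hu
    rw [uIcc_of_le hb] at hu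
    have hi : ∀ s t, IntervalIntegrable (fun v => B (c - u - v) * A v) volume s t := fun s t =>
      Continuous.intervalIntegrable (by fun_prop) s t
    have hsub := intervalIntegral.integral_comp_sub_right (a := b) (b := c)
      (fun v => B (c - u - v) * A v) u
    simp only [sub_sub_sub_cancel_right] at hsub
    rw [hsub, hAB (c - u) (by linarith [hu.2]),
      ← intervalIntegral.integral_add_adjacent_intervals (hi 0 (b - u)) (hi (b - u) (c - u))]
    ring
  have hswap : ∫ y in b..c, B (c - y) * ∫ u in (0 : ℝ)..b, A (y - u) * V u =
      ∫ u in (0 : ℝ)..b, V u * ∫ y in b..c, B (c - y) * A (y - u) := by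
    simp_rw [← intervalIntegral.integral_const_mul]
    rw [intervalIntegral_intervalIntegral_swap]
    · refine intervalIntegral.integral_congr fun u _ =>
        intervalIntegral.integral_congr fun y _ => ?_
      ring
    · have : Continuous (Function.uncurry fun y u => B (c - y) * (A (y - u) * V u)) := by
        fun_prop
      exact (this.continuousOn.integrableOn_compact (isCompact_uIcc.prod isCompact_uIcc)).mono_set
        (prod_mono uIoc_subset_uIcc uIoc_subset_uIcc)
  have hconv : ∫ y in b..c, B (c - y) * refractedZ α b q V A y =
      (∫ y in b..c, B (c - y) * (1 + q * ∫ z in (0 : ℝ)..y, A z)) -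
        α * q * ∫ y in b..c, B (c - y) * ∫ u in (0 : ℝ)..b, A (y - u) * V u := by
    rw [← intervalIntegral.integral_const_mul, ← intervalIntegral.integral_sub]
    · refine intervalIntegral.integral_congr fun y hy => ?_
      rw [uIcc_of_le hc] at hy
      simp only [refractedZ_eq_of_convolution hA hV hb hAV hy.1]
      ring
    · exact Continuous.intervalIntegrable (by fun_prop) _ _
    · exact Continuous.intervalIntegrable (by fun_prop) _ _
  have hmul : q * ∫ u in (0 : ℝ)..b, V u * ∫ y in b..c, B (c - y) * A (y - u) =
      (∫ u in (0 : ℝ)..b, A (c - u) * V u) - ∫ u in (0 : ℝ)..b,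
          V u * (B (c - u) + q * ∫ v in (0 : ℝ)..(b - u), B (c - u - v) * A v) := by
    rw [← intervalIntegral.integral_const_mul, ← intervalIntegral.integral_sub]
    · refine intervalIntegral.integral_congr fun u hu => ?_
      have := hinner u hu
      linear_combination V u * this
    · exact Continuous.intervalIntegrable (by fun_prop) _ _
    · exact Continuous.intervalIntegrable (by fun_prop) _ _
  have hi : ∀ s t, IntervalIntegrable
      (fun y => B (c - y) * (1 + q * ∫ z in (0 : ℝ)..y, A z)) volume s t := fun s t =>
    Continuous.intervalIntegrable (by fun_prop) s t
  have hsplit := intervalIntegral.integral_add_adjacent_intervals (hi 0 b) (hi b c)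
  rw [hBZ c (hb.trans hc)] at hsplit
  rw [refractedZ_eq_of_convolution hA hV hb hAV hc, hconv, hswap]
  linear_combination (-q) * hsplit + (α * q) * hmul

theorem tendsto_intervalIntegral_shift_mul {L K : ℝ} (hB : Continuous B) (hK : ∀ x, |B x| ≤ K)
    (hlim : Tendsto B atTop (𝓝 L)) (hA : Continuous A) (d e : ℝ) :
    Tendsto (fun c => ∫ v in (0 : ℝ)..d, B (c - e - v) * A v) atTop
      (𝓝 (L * ∫ v in (0 : ℝ)..d, A v)) := by
  rw [← intervalIntegral.integral_const_mul]
  refine intervalIntegral.tendsto_integral_filter_of_dominated_convergence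
    (fun v => K * |A v|) ?_ ?_ ?_ ?_
  · exact Eventually.of_forall fun c => Continuous.aestronglyMeasurable (by fun_prop)
  · refine Eventually.of_forall fun c => ae_of_all _ fun v _ => ?_
    rw [Real.norm_eq_abs, abs_mul]
    gcongr
    exact hK _
  · exact Continuous.intervalIntegrable (by fun_prop) _ _
  · refine ae_of_all _ fun v _ => Tendsto.mul_const _ (hlim.comp ?_)
    simp_rw [sub_sub]
    exact tendsto_atTop_add_const_right _ _ tendsto_id

theorem tendsto_refracted_boundary_terms {L K : ℝ} (hB : Continuous B) (hK : ∀ x, |B x| ≤ K)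
    (hlim : Tendsto B atTop (𝓝 L)) (hA : Continuous A) (hV : Continuous V) (hb : 0 ≤ b) :
    Tendsto (fun c => 1 + q * (∫ y in (0 : ℝ)..b, B (c - y) * (1 + q * ∫ z in (0 : ℝ)..y, A z)) -
        α * q * ∫ u in (0 : ℝ)..b,
          V u * (B (c - u) + q * ∫ v in (0 : ℝ)..(b - u), B (c - u - v) * A v)) atTop
      (𝓝 (1 + L * (q * ∫ y in (0 : ℝ)..b, ((1 + q * ∫ z in (0 : ℝ)..y, A z) -
          α * V y * (1 + q * ∫ z in (0 : ℝ)..(b - y), A z))))) := by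
  have hZ : Continuous fun y => 1 + q * ∫ z in (0 : ℝ)..y, A z := by fun_prop
  have h1 := tendsto_intervalIntegral_shift_mul hB hK hlim hZ b 0
  simp only [sub_zero] at h1
  have hK0 : 0 ≤ K := (abs_nonneg _).trans (hK 0)
  have h2 : Tendsto (fun c => ∫ u in (0 : ℝ)..b,
      V u * (B (c - u) + q * ∫ v in (0 : ℝ)..(b - u), B (c - u - v) * A v)) atTop
      (𝓝 (∫ u in (0 : ℝ)..b, V u * (L + q * (L * ∫ v in (0 : ℝ)..(b - u), A v)))) := by
    refine intervalIntegral.tendsto_integral_filter_of_dominated_convergence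
      (fun u => |V u| * (K + |q| * ∫ v in (0 : ℝ)..(b - u), K * |A v|)) ?_ ?_ ?_ ?_
    · exact Eventually.of_forall fun c => Continuous.aestronglyMeasurable (by fun_prop)
    · refine Eventually.of_forall fun c => ae_of_all _ fun u hu => ?_
      rw [uIoc_of_le hb] at hu
      rw [Real.norm_eq_abs, abs_mul]
      gcongr
      refine (abs_add_le _ _).trans (add_le_add (hK _) ?_)
      rw [abs_mul]
      gcongr
      rw [← Real.norm_eq_abs]
      refine intervalIntegral.norm_integral_le_of_norm_le (by linarith [hu.2])
        (ae_of_all _ fun v _ => ?_) (Continuous.intervalIntegrable (by fun_prop) _ _)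
      rw [Real.norm_eq_abs, abs_mul]
      gcongr
      exact hK _
    · exact Continuous.intervalIntegrable (by fun_prop) _ _
    · refine ae_of_all _ fun u _ => Tendsto.const_mul _ (Tendsto.add (hlim.comp ?_) ?_)
      · exact tendsto_atTop_add_const_right _ _ tendsto_id
      · exact (tendsto_intervalIntegral_shift_mul hB hK hlim hA (b - u) u).const_mul q
  convert ((h1.const_mul q).const_add 1).sub (h2.const_mul (α * q)) using 2
  rw [intervalIntegral.integral_sub]
  · have e1 : ∫ u in (0 : ℝ)..b, V u * (L + q * (L * ∫ v in (0 : ℝ)..(b - u), A v)) =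
        L * ∫ u in (0 : ℝ)..b, V u * (1 + q * ∫ v in (0 : ℝ)..(b - u), A v) := by
      rw [← intervalIntegral.integral_const_mul]
      congr 1 with u
      ring
    simp_rw [mul_assoc α]
    rw [e1, intervalIntegral.integral_const_mul]
    ring
  · exact hZ.intervalIntegrable _ _
  · exact Continuous.intervalIntegrable (by fun_prop) _ _

end Refraction

section LaplaceExponent

/-- The integrand of the jump part of the Laplace exponent. -/
noncomputable def levyKernel (l z : ℝ) : ℝ :=
  Real.exp (-l * z) - 1 + l * z * Set.indicator (Set.Ioc (0 : ℝ) 1) (fun _ => (1 : ℝ)) z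

theorem integrableOn_min_one_sq {ν : Measure ℝ} (hν : IsLevyMeasure ν) :
    IntegrableOn (fun z : ℝ => min 1 (z ^ 2)) (Ioi 0) ν := by
  refine ⟨by fun_prop, ?_⟩
  rw [hasFiniteIntegral_iff_ofReal (ae_of_all _ fun z => by positivity)]
  exact hν.2.lt_top

theorem integrableOn_levyKernel {ν : Measure ℝ} (hν : IsLevyMeasure ν) {l : ℝ} (hl : 0 ≤ l) :
    IntegrableOn (levyKernel l) (Ioi 0) ν := by
  have hmeas : Measurable (levyKernel l) := by
    unfold levyKernel
    exact ((by fun_prop : Measurable fun z : ℝ => Real.exp (-l * z) - 1)).add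
      ((by fun_prop : Measurable fun z : ℝ => l * z).mul
        (measurable_const.indicator measurableSet_Ioc))
  refine ((integrableOn_min_one_sq hν).const_mul (l ^ 2 + 1)).mono' hmeas.aestronglyMeasurable ?_
  refine (ae_restrict_iff' measurableSet_Ioi).2 (ae_of_all _ fun z (hz : 0 < z) => ?_)
  have hlz : 0 ≤ l * z := by positivity
  have h0 := Real.exp_pos (-l * z)
  have h1 : Real.exp (-l * z) ≤ 1 := Real.exp_le_one_iff.2 (by linarith)
  rw [Real.norm_eq_abs, levyKernel]
  rcases le_or_gt z 1 with hz1 | hz1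
  · rw [indicator_of_mem (show z ∈ Ioc (0 : ℝ) 1 from ⟨hz, hz1⟩), mul_one,
      min_eq_right (by nlinarith)]
    have h2 := Real.add_one_le_exp (-l * z)
    have h3 : Real.exp (-l * z) - 1 + l * z ≤ (l * z) ^ 2 := by
      have h4 := Real.add_one_le_exp (l * z)
      have h5 : Real.exp (-l * z) * Real.exp (l * z) = 1 := by
        rw [← Real.exp_add]; simp
      nlinarith [mul_le_mul_of_nonneg_left h4 h0.le]
    rw [abs_of_nonneg (by linarith)]
    nlinarith [sq_nonneg z]
  · rw [indicator_of_notMem (fun h => absurd h.2 (not_le.2 hz1)), mul_zero, add_zero,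
      min_eq_left (by nlinarith), abs_le]
    constructor <;> nlinarith [sq_nonneg l]

theorem measure_Ioi_ne_top {ν : Measure ℝ} (hν : IsLevyMeasure ν) {δ : ℝ} (hδ : 0 < δ) :
    ν (Ioi δ) ≠ ⊤ := by
  have h := (integrableOn_min_one_sq hν).measure_ge_lt_top (ε := min 1 (δ ^ 2)) (by positivity)
  rw [Measure.restrict_apply (measurableSet_le measurable_const (by fun_prop))] at h
  refine ((measure_mono fun z (hz : δ < z) => ?_).trans_lt h).ne
  refine ⟨?_, hδ.trans hz⟩
  change min 1 (δ ^ 2) ≤ min 1 (z ^ 2)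
  gcongr

theorem integrableOn_id_Ioc {ν : Measure ℝ} (hν : IsLevyMeasure ν) {δ : ℝ} (hδ : 0 < δ) :
    IntegrableOn (fun z : ℝ => z) (Ioc δ 1) ν := by
  have hfin : IntegrableOn (fun _ => (1 : ℝ)) (Ioi δ) ν :=
    integrableOn_const (measure_Ioi_ne_top hν hδ)
  refine Integrable.mono' (hfin.mono_set Ioc_subset_Ioi_self) (by fun_prop) ?_
  refine (ae_restrict_iff' measurableSet_Ioc).2 (ae_of_all _ fun z hz => ?_)
  rw [Real.norm_eq_abs, abs_of_pos (hδ.trans hz.1)]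
  exact hz.2

/-- Truncating the jumps of size at most `δ` bounds the Laplace exponent from below. -/
theorem le_levyPsi {γ σ : ℝ} {ν : Measure ℝ} (hν : IsLevyMeasure ν) {δ l : ℝ} (hδ : 0 < δ)
    (hδ1 : δ ≤ 1) (hl : 0 ≤ l) :
    (γ + ∫ z in Ioc δ 1, z ∂ν) * l + σ ^ 2 / 2 * l ^ 2 - ν.real (Ioi δ) ≤ levyPsi γ σ ν l := by
  have hfin : IntegrableOn (fun _ => (1 : ℝ)) (Ioi δ) ν :=
    integrableOn_const (measure_Ioi_ne_top hν hδ)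
  have hz := integrableOn_id_Ioc hν hδ
  have hsub1 : Ioi (0 : ℝ) ∩ Ioc δ 1 = Ioc δ 1 :=
    inter_eq_right.2 fun z hz => hδ.trans hz.1
  have hsub2 : Ioi (0 : ℝ) ∩ Ioi δ = Ioi δ := inter_eq_right.2 (Ioi_subset_Ioi hδ.le)
  have i1 : IntegrableOn (indicator (Ioc δ 1) fun z => l * z) (Ioi 0) ν :=
    (IntegrableOn.integrable_indicator (hz.const_mul l) measurableSet_Ioc).integrableOn
  have i2 : IntegrableOn (indicator (Ioi δ) fun _ => (1 : ℝ)) (Ioi 0) ν :=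
    (hfin.integrable_indicator measurableSet_Ioi).integrableOn
  have key : ∫ z in Ioi (0 : ℝ), (indicator (Ioc δ 1) (fun z => l * z) z -
      indicator (Ioi δ) (fun _ => (1 : ℝ)) z) ∂ν ≤ ∫ z in Ioi (0 : ℝ), levyKernel l z ∂ν := by
    refine setIntegral_mono_on (i1.sub i2) (integrableOn_levyKernel hν hl) measurableSet_Ioi
      fun z (hz : 0 < z) => ?_
    have h0 := Real.exp_pos (-l * z)
    have h2 := Real.add_one_le_exp (-l * z)
    simp only [levyKernel, indicator, mem_Ioc, mem_Ioi]
    split_ifs <;> first | (exfalso; grind) | linarith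
  rw [integral_sub i1 i2, setIntegral_indicator measurableSet_Ioc,
    setIntegral_indicator measurableSet_Ioi, hsub1, hsub2, integral_const_mul,
    setIntegral_const, smul_eq_mul, mul_one] at key
  change _ ≤ γ * l + σ ^ 2 / 2 * l ^ 2 + ∫ z in Ioi (0 : ℝ), levyKernel l z ∂ν
  linarith

theorem exists_lt_integral_Ioc {ν : Measure ℝ} (hν : IsLevyMeasure ν) {r : ℝ}
    (hr : smallJumpMass ν ≠ ⊤ → r < (smallJumpMass ν).toReal) :
    ∃ δ > 0, δ ≤ 1 ∧ r < ∫ z in Ioc δ 1, z ∂ν := by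
  rcases lt_or_ge r 0 with hr0 | hr0
  · exact ⟨1, one_pos, le_rfl, by simpa using hr0⟩
  have hlt : ENNReal.ofReal r < smallJumpMass ν := by
    by_cases htop : smallJumpMass ν = ⊤
    · rw [htop]
      exact ENNReal.ofReal_lt_top
    · exact (ENNReal.ofReal_lt_iff_lt_toReal hr0 htop).2 (hr htop)
  let μ := ν.withDensity ENNReal.ofReal
  have hμ : ∀ δ : ℝ, μ (Ioc δ 1) = ∫⁻ z in Ioc δ 1, ENNReal.ofReal z ∂ν := fun δ =>
    withDensity_apply _ measurableSet_Ioc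
  have hmono : Monotone fun n : ℕ => Ioc (1 / ((n : ℝ) + 1)) 1 := fun m n hmn =>
    Ioc_subset_Ioc_left (one_div_le_one_div_of_le (by positivity) (by gcongr))
  have hUnion : ⋃ n : ℕ, Ioc (1 / ((n : ℝ) + 1)) 1 = Ioc (0 : ℝ) 1 := by
    ext z
    simp only [mem_iUnion, mem_Ioc, exists_and_right]
    refine and_congr_left fun _ => ⟨fun ⟨n, hn⟩ => lt_trans (by positivity) hn, fun hz => ?_⟩
    exact exists_nat_one_div_lt hz
  have hlim := tendsto_measure_iUnion_atTop (μ := μ) hmono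
  rw [hUnion, hμ] at hlim
  obtain ⟨n, hn⟩ := (hlim.eventually (lt_mem_nhds hlt)).exists
  have hδ : (0 : ℝ) < 1 / ((n : ℝ) + 1) := by positivity
  refine ⟨1 / ((n : ℝ) + 1), hδ, ?_, ?_⟩
  · rw [div_le_one (by positivity)]
    linarith [n.cast_nonneg (α := ℝ)]
  · simp only [Function.comp_apply, hμ] at hn
    rw [← ofReal_integral_eq_lintegral_ofReal (integrableOn_id_Ioc hν hδ)
      ((ae_restrict_iff' measurableSet_Ioc).2 (ae_of_all _ fun z hz => (hδ.trans hz.1).le))] at hn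
    exact (ENNReal.ofReal_lt_ofReal_iff_of_nonneg hr0).1 hn

/-- After subtracting an admissible drift, the Laplace exponent still grows linearly. -/
theorem exists_linear_le_levyPsi_sub {γ σ α : ℝ} {ν : Measure ℝ} (hσ : 0 ≤ σ)
    (hν : IsLevyMeasure ν) (hα : AlphaAdmissible γ σ α ν) :
    ∃ ε > 0, ∃ C, ∀ l ≥ 0, ε * l - C ≤ levyPsi γ σ ν l - α * l := by
  rcases hσ.eq_or_lt with rfl | hσ
  · obtain ⟨δ, hδ, hδ1, h⟩ := exists_lt_integral_Ioc hν (r := α - γ) fun h => by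
      linarith [hα.2 ⟨rfl, h⟩]
    refine ⟨γ + (∫ z in Ioc δ 1, z ∂ν) - α, by linarith, ν.real (Ioi δ), fun l hl => ?_⟩
    linarith [le_levyPsi (γ := γ) (σ := 0) hν hδ hδ1 hl]
  · refine ⟨1, one_pos, ν.real (Ioi 1) + (γ - α - 1) ^ 2 / (2 * σ ^ 2), fun l hl => ?_⟩
    have h := le_levyPsi (γ := γ) (σ := σ) hν one_pos le_rfl hl
    have hsq : (γ - α - 1) * l + σ ^ 2 / 2 * l ^ 2 + (γ - α - 1) ^ 2 / (2 * σ ^ 2) =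
        (σ ^ 2 * l + (γ - α - 1)) ^ 2 / (2 * σ ^ 2) := by
      field_simp
      ring
    have : 0 ≤ (σ ^ 2 * l + (γ - α - 1)) ^ 2 / (2 * σ ^ 2) := by positivity
    simp only [Ioc_self, setIntegral_empty, add_zero] at h
    linarith

theorem levyPhi_nonneg (f : ℝ → ℝ) (p : ℝ) : 0 ≤ levyPhi f p :=
  Real.sSup_nonneg fun _ h => h.1

theorem ne_of_levyPhi_lt {f : ℝ → ℝ} {ε C p l : ℝ} (hε : 0 < ε)
    (hf : ∀ l ≥ 0, ε * l - C ≤ f l) (hl : levyPhi f p < l) : f l ≠ p := by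
  intro h
  refine hl.not_ge (le_csSup ⟨(p + C) / ε, fun k hk => ?_⟩
    ⟨(levyPhi_nonneg f p).trans hl.le, h⟩)
  rw [le_div_iff₀ hε]
  linarith [hf k hk.1, hk.2]

theorem IsScaleFunction.hasLaplace {f W : ℝ → ℝ} {ε C p l : ℝ} (hε : 0 < ε)
    (hf : ∀ l ≥ 0, ε * l - C ≤ f l) (hW : IsScaleFunction f (levyPhi f p) p W)
    (hl : levyPhi f p < l) :
    HasLaplace (fun x => W (max 0 x)) l (1 / (f l - p)) := by
  have hne : f l - p ≠ 0 := sub_ne_zero.2 (ne_of_levyPhi_lt hε hf hl)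
  have hint := hW.2.2.2 l hl
  have : HasLaplace W l (1 / (f l - p)) :=
    ⟨Integrable.of_integral_ne_zero (by rw [hint]; exact one_div_ne_zero hne), hint⟩
  exact this.congr fun x (hx : 0 < x) => by rw [max_eq_right hx.le]

end LaplaceExponent

theorem exists_abs_comp_max_le_of_tendsto {f : ℝ → ℝ} {L : ℝ} (hf : ContinuousOn f (Ici 0))
    (hlim : Tendsto f atTop (𝓝 L)) : ∃ K, ∀ x, |f (max 0 x)| ≤ K := by
  obtain ⟨N, hN⟩ := eventually_atTop.1 (hlim.abs.eventually (ge_mem_nhds (lt_add_one |L|)))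
  obtain ⟨K, hK⟩ := isCompact_Icc.exists_bound_of_continuousOn
    (hf.mono (Icc_subset_Ici_self (a := N) (b := (0 : ℝ))))
  refine ⟨max K (|L| + 1), fun x => ?_⟩
  rcases le_total N (max 0 x) with h | h
  · exact (hN _ h).trans (le_max_right _ _)
  · exact (hK _ ⟨le_max_left _ _, h⟩).trans (le_max_left _ _)

theorem refractedZ_comp_max {α b q x : ℝ} (W A : ℝ → ℝ) (hb : 0 ≤ b) (hx : 0 ≤ x) :
    refractedZ α b q (fun y => W (max 0 y)) (fun y => A (max 0 y)) x =
      refractedZ α b q W A x := by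
  have h1 : ∫ y in (0 : ℝ)..x, W (max 0 y) = ∫ y in (0 : ℝ)..x, W y :=
    intervalIntegral.integral_congr fun y hy => by
      rw [uIcc_of_le hx] at hy
      simp only [max_eq_right hy.1]
  have h2 : b ≤ x → ∫ y in b..x, A (max 0 (x - y)) * W (max 0 y) =
      ∫ y in b..x, A (x - y) * W y := fun hbx =>
    intervalIntegral.integral_congr fun y hy => by
      rw [uIcc_of_le hbx] at hy
      simp only [max_eq_right (hb.trans hy.1), max_eq_right (sub_nonneg.2 hy.2)]
  unfold refractedZ
  split_ifs with h
  · rw [h1, h2 h]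
  · rw [h1]

/-- If `𝕎` has a finite positive limit `L` at infinity, then
`lim_{c→∞} [ z^{(q)}(c;0) - q∫_b^c 𝕎(c-y) z^{(q)}(y;0) dy ] / 𝕎(c)
  = 1/L + q∫₀^b ( ℤ^{(q)}(y) - α W^{(q)}(y) ℤ^{(q)}(b-y) ) dy`. -/
theorem refracted_z_limit_ratio
    (γ σ : ℝ) (hσ : 0 ≤ σ) (ν : Measure ℝ) (hν : IsLevyMeasure ν)
    (hnd : NonDegenerate γ σ ν)
    (α : ℝ) (hα : AlphaAdmissible γ σ α ν)
    (b : ℝ) (hb : 0 < b) (q : ℝ) (hq : 0 ≤ q)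
    (W Wαq Wα0 : ℝ → ℝ)
    (hW : IsScaleFunction (levyPsi γ σ ν) (levyPhi (levyPsi γ σ ν) q) q W)
    (hWαq : IsScaleFunction (fun l => levyPsi γ σ ν l - α * l)
      (levyPhi (fun l => levyPsi γ σ ν l - α * l) q) q Wαq)
    (hWα0 : IsScaleFunction (fun l => levyPsi γ σ ν l - α * l)
      (levyPhi (fun l => levyPsi γ σ ν l - α * l) 0) 0 Wα0)
    (L : ℝ) (hL : 0 < L) (hlim : Tendsto Wα0 atTop (nhds L)) :
    Tendsto
      (fun c : ℝ =>
        (refractedZ α b q W Wαq c -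
            q * ∫ y in b..c, Wα0 (c - y) * refractedZ α b q W Wαq y) / Wα0 c)
      atTop
      (nhds (1 / L + q * ∫ y in (0:ℝ)..b,
        ((1 + q * ∫ z in (0:ℝ)..y, Wαq z) -
          α * W y * (1 + q * ∫ z in (0:ℝ)..(b - y), Wαq z)))) := by
  obtain ⟨ε, hε, C, hlin⟩ := exists_linear_le_levyPsi_sub hσ hν hα
  have hlin' : ∀ l ≥ 0, ε * l - C ≤ levyPsi γ σ ν l := fun l hl => by
    linarith [hlin l hl, mul_nonneg hα.1.le hl]
  have hcont : ∀ {f : ℝ → ℝ}, ContinuousOn f (Ici 0) → Continuous fun x => f (max 0 x) :=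
    fun hf => hf.comp_continuous (by fun_prop) fun x => mem_Ici.2 (le_max_left _ _)
  set V : ℝ → ℝ := fun x => W (max 0 x) with hVdef
  set A : ℝ → ℝ := fun x => Wαq (max 0 x) with hAdef
  set B : ℝ → ℝ := fun x => Wα0 (max 0 x) with hBdef
  have hV : Continuous V := hcont hW.2.1
  have hA : Continuous A := hcont hWαq.2.1
  have hB : Continuous B := hcont hWα0.2.1
  set Φ := max (levyPhi (levyPsi γ σ ν) q)
    (max (levyPhi (fun l => levyPsi γ σ ν l - α * l) q)
      (levyPhi (fun l => levyPsi γ σ ν l - α * l) 0)) with hΦ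
  have hΦV : ∀ l > Φ, levyPhi (levyPsi γ σ ν) q < l := fun l hl =>
    (le_max_left _ _).trans_lt hl
  have hΦA : ∀ l > Φ, levyPhi (fun l => levyPsi γ σ ν l - α * l) q < l := fun l hl =>
    ((le_max_left _ _).trans (le_max_right _ _)).trans_lt hl
  have hΦB : ∀ l > Φ, levyPhi (fun l => levyPsi γ σ ν l - α * l) 0 < l := fun l hl =>
    ((le_max_right _ _).trans (le_max_right _ _)).trans_lt hl
  have hpos : ∀ l > Φ, 0 < l := fun l hl => (levyPhi_nonneg _ _).trans_lt (hΦV l hl)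
  have neV : ∀ l > Φ, levyPsi γ σ ν l - q ≠ 0 := fun l hl =>
    sub_ne_zero.2 (ne_of_levyPhi_lt hε hlin' (hΦV l hl))
  have neA : ∀ l > Φ, levyPsi γ σ ν l - α * l - q ≠ 0 := fun l hl =>
    sub_ne_zero.2 (ne_of_levyPhi_lt (f := fun l => levyPsi γ σ ν l - α * l) hε hlin (hΦA l hl))
  have neB : ∀ l > Φ, levyPsi γ σ ν l - α * l ≠ 0 := fun l hl =>
    ne_of_levyPhi_lt (f := fun l => levyPsi γ σ ν l - α * l) hε hlin (hΦB l hl)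
  have lapV : ∀ l > Φ, HasLaplace V l (1 / (levyPsi γ σ ν l - q)) := fun l hl =>
    hW.hasLaplace hε hlin' (hΦV l hl)
  have lapA : ∀ l > Φ, HasLaplace A l (1 / (levyPsi γ σ ν l - α * l - q)) := fun l hl =>
    hWαq.hasLaplace hε hlin (hΦA l hl)
  have lapB : ∀ l > Φ, HasLaplace B l (1 / (levyPsi γ σ ν l - α * l)) := fun l hl => by
    simpa only [sub_zero] using hWα0.hasLaplace hε hlin (hΦB l hl)
  have hAB : ∀ x ≥ 0, A x - B x = q * ∫ y in (0 : ℝ)..x, B (x - y) * A y :=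
    HasLaplace.eqOn (by fun_prop) (by fun_prop) (fun l hl => (lapA l hl).sub (lapB l hl))
      fun l hl => by
        convert ((lapB l hl).conv (lapA l hl)).const_mul q using 1
        have := neA l hl
        have := neB l hl
        field_simp
        ring
  have hAV : ∀ x ≥ 0, (∫ y in (0 : ℝ)..x, A y) - ∫ y in (0 : ℝ)..x, V y =
      α * ∫ y in (0 : ℝ)..x, A (x - y) * V y :=
    HasLaplace.eqOn (by fun_prop) (by fun_prop)
      (fun l hl => ((lapA l hl).primitive (hpos l hl)).sub ((lapV l hl).primitive (hpos l hl)))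
      fun l hl => by
        convert ((lapA l hl).conv (lapV l hl)).const_mul α using 1
        have := neA l hl
        have := neV l hl
        have := (hpos l hl).ne'
        field_simp
        ring
  have hBZ : ∀ x ≥ 0, ∫ y in (0 : ℝ)..x, B (x - y) * (1 + q * ∫ z in (0 : ℝ)..y, A z) =
      ∫ y in (0 : ℝ)..x, A y :=
    HasLaplace.eqOn (by fun_prop) (by fun_prop)
      (fun l hl => (lapB l hl).conv ((HasLaplace.one (hpos l hl)).add
        (((lapA l hl).primitive (hpos l hl)).const_mul q)))
      fun l hl => by
        convert (lapA l hl).primitive (hpos l hl) using 1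
        have := neA l hl
        have := neB l hl
        have := (hpos l hl).ne'
        field_simp
        ring
  obtain ⟨K, hK⟩ := exists_abs_comp_max_le_of_tendsto hWα0.2.1 hlim
  have hBlim : Tendsto B atTop (𝓝 L) :=
    hlim.congr' ((eventually_ge_atTop 0).mono fun x hx => by simp only [hBdef, max_eq_right hx])
  have hmain := (tendsto_refracted_boundary_terms (q := q) (α := α) hB hK hBlim hA hV hb.le).div
    hlim hL.ne'
  have hconst : (1 + L * (q * ∫ y in (0 : ℝ)..b, ((1 + q * ∫ z in (0 : ℝ)..y, A z) -
        α * V y * (1 + q * ∫ z in (0 : ℝ)..(b - y), A z)))) / L =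
      1 / L + q * ∫ y in (0:ℝ)..b, ((1 + q * ∫ z in (0:ℝ)..y, Wαq z) -
          α * W y * (1 + q * ∫ z in (0:ℝ)..(b - y), Wαq z)) := by
    have hprim : ∀ x ≥ 0, ∫ z in (0 : ℝ)..x, A z = ∫ z in (0 : ℝ)..x, Wαq z := fun x hx =>
      intervalIntegral.integral_congr fun z hz => by
        rw [uIcc_of_le hx] at hz
        simp only [hAdef, max_eq_right hz.1]
    rw [add_div, mul_div_cancel_left₀ _ hL.ne']
    congr 2
    refine intervalIntegral.integral_congr fun y hy => ?_
    rw [uIcc_of_le hb.le] at hy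
    simp only [hprim y hy.1, hprim (b - y) (sub_nonneg.2 hy.2), hVdef, max_eq_right hy.1]
  rw [hconst] at hmain
  refine hmain.congr' ((eventually_ge_atTop b).mono fun c hc => ?_)
  rw [Pi.div_apply, ← refractedZ_sub_convolution_eq hA hB hV hb.le hAB hAV hBZ hc,
    refractedZ_comp_max W Wαq hb.le (hb.le.trans hc)]
  congr 3
  refine intervalIntegral.integral_congr fun y hy => ?_
  rw [uIcc_of_le hc] at hy
  simp only [hBdef, hVdef, hAdef, refractedZ_comp_max W Wαq hb.le (hb.le.trans hy.1),
    max_eq_right (sub_nonneg.2 hy.2)]
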